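/- Let $\kk$ be a field and $A$ a $d \times n$ integer matrix. The quotient ring $\kk[x_1, \dots, x_n, \xi_1, \dots, \xi_n] / (I_A + \langle Ax\xi \rangle)$ has Krull dimension at least $n$. -/

import Mathlib

open MvPolynomial

/-- The toric ideal of an integer matrix `A`, generated by the binomials
`ξ^u - ξ^v` over pairs `u v : ℕⁿ` with `Au = Av`, inside a polynomial ring
whose variables include `ξ j = ξvar j`. -/
noncomputable def toricIdeal (k : Type*) [Field k] {d n : ℕ}
    (A : Matrix (Fin d) (Fin n) ℤ) {σ : Type*} (ξvar : Fin n → σ) :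
    Ideal (MvPolynomial σ k) :=
  Ideal.span { f | ∃ u v : Fin n → ℕ,
    A.mulVec (fun j => (u j : ℤ)) = A.mulVec (fun j => (v j : ℤ)) ∧
    f = (∏ j, X (ξvar j) ^ u j) - ∏ j, X (ξvar j) ^ v j }

/-- The ideal `⟨Axξ⟩` generated by the `d` Euler forms `∑ⱼ aᵢⱼ xⱼ ξⱼ` in
`k[x₁,…,xₙ,ξ₁,…,ξₙ]`, where `x j = X (Sum.inl j)` and `ξ j = X (Sum.inr j)`. -/
noncomputable def eulerIdeal (k : Type*) [Field k] {d n : ℕ}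
    (A : Matrix (Fin d) (Fin n) ℤ) :
    Ideal (MvPolynomial (Fin n ⊕ Fin n) k) :=
  Ideal.span { f | ∃ i : Fin d,
    f = ∑ j, (A i j : MvPolynomial (Fin n ⊕ Fin n) k) *
          X (Sum.inl j) * X (Sum.inr j) }

theorem ringKrullDim_le_of_integral_inj {R S : Type*} [CommRing R] [CommRing S] [Algebra R S]
    [Algebra.IsIntegral R S] [FaithfulSMul R S] : ringKrullDim R ≤ ringKrullDim S := by
  unfold ringKrullDim
  refine iSup_le fun l => ?_
  obtain ⟨P, hP⟩ := Algebra.IsIntegral.comap_surjective R S l.head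
  have : P.asIdeal.LiesOver (RelSeries.head l).asIdeal := ⟨by rw [← hP]; rfl⟩
  obtain ⟨L, hL, -⟩ := Ideal.exists_ltSeries_of_hasGoingUp l P.asIdeal
  rw [← hL]
  exact le_iSup (fun L : LTSeries (PrimeSpectrum S) => (L.length : WithBot ℕ∞)) L

theorem card_le_ringKrullDim_of_algebraicIndependent {k B ι : Type*} [Field k] [CommRing B]
    [IsDomain B] [Algebra k B] [Algebra.FiniteType k B] [Finite ι] (x : ι → B)
    (hx : AlgebraicIndependent k x) : (Nat.card ι : WithBot ℕ∞) ≤ ringKrullDim B := by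
  obtain ⟨s, g, hg, hint⟩ := exists_integral_inj_algHom_of_fg k B
  let _ := g.toRingHom.toAlgebra
  have : IsScalarTower k (MvPolynomial (Fin s) k) B := .of_algHom g
  have : Algebra.IsIntegral (MvPolynomial (Fin s) k) B := ⟨hint⟩
  have : FaithfulSMul (MvPolynomial (Fin s) k) B :=
    (faithfulSMul_iff_algebraMap_injective _ _).mpr hg
  have h1 : ringKrullDim (MvPolynomial (Fin s) k) ≤ ringKrullDim B :=
    ringKrullDim_le_of_integral_inj
  simp only [MvPolynomial.ringKrullDim_of_isNoetherianRing, ringKrullDim_eq_zero_of_field,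
    Nat.card_fin, zero_add] at h1
  refine le_trans ?_ h1
  have hb := (IsTranscendenceBasis.mvPolynomial (Fin s) k).algebraMap_comp (A := B)
  have h2 := hx.lift_cardinalMk_le_trdeg
  have h3 := hb.lift_cardinalMk_eq_trdeg
  have := Fintype.ofFinite ι
  have h4 : Algebra.trdeg k B = s := by simpa using h3.symm
  rw [h4] at h2
  have : Fintype.card ι ≤ s := by simpa using h2
  rw [Nat.card_eq_fintype_card]
  exact_mod_cast this

theorem exists_lin_data (k : Type*) [Field k] {d n : ℕ} (A : Matrix (Fin d) (Fin n) ℤ) :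
    ∃ (r m : ℕ) (c : Fin r → Fin n) (V : Matrix (Fin n) (Fin m) k) (G : Matrix (Fin m) (Fin n) k),
      LinearIndependent ℤ (fun j => A.col (c j)) ∧ (A.map (Int.cast : ℤ → k)) * V = 0 ∧
      G * V = 1 ∧ n ≤ r + m := by
  classical
  -- columns over `ℚ`
  let q : (Fin d → ℤ) →ₗ[ℤ] (Fin d → ℚ) := (Int.castAddHom ℚ).toIntLinearMap.compLeft (Fin d)
  have hq : Function.Injective q := fun a b h => by
    funext i
    have := congrFun h i
    simpa [q] using this
  obtain ⟨κ, a, ha, hspan, hli⟩ := exists_linearIndependent' ℚ (fun j => q (A.col j))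
  have : Finite κ := Finite.of_injective a ha
  have := Fintype.ofFinite κ
  let M : Submodule ℤ (Fin d → ℤ) := Submodule.span ℤ (Set.range A.col)
  let b := Module.finBasis ℤ M
  have hr : Module.finrank ℤ M ≤ Fintype.card κ := by
    have h1 : LinearIndependent ℤ (fun i => q (b i : Fin d → ℤ)) :=
      (b.linearIndependent.map' M.subtype M.ker_subtype).map' q (LinearMap.ker_eq_bot.mpr hq)
    rw [LinearIndependent.iff_fractionRing ℤ ℚ] at h1
    have h2 : ∀ x ∈ M, q x ∈ Submodule.span ℚ (Set.range fun j => q (A.col j)) := by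
      intro x hx
      induction hx using Submodule.span_induction with
      | mem x h => obtain ⟨j, rfl⟩ := h; exact Submodule.subset_span ⟨j, rfl⟩
      | zero => simp
      | add x y _ _ h h' => rw [map_add]; exact add_mem h h'
      | smul z x _ h => rw [map_smul]; exact zsmul_mem h z
    have h5 := finrank_span_eq_card hli
    have h6 : Submodule.span ℚ (Set.range fun i => q (b i : Fin d → ℤ)) ≤
        Submodule.span ℚ (Set.range ((fun j => q (A.col j)) ∘ a)) := by
      rw [hspan, Submodule.span_le]
      rintro _ ⟨i, rfl⟩
      exact h2 _ (b i).2
    have h7 := Submodule.finrank_mono h6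
    rw [finrank_span_eq_card h1, h5] at h7
    simpa using h7
  let Ak := A.map (Int.cast : ℤ → k)
  let K := LinearMap.ker Ak.mulVecLin
  let v := Module.finBasis k K
  let e := Fintype.equivFin κ
  have hrk : Module.finrank k (LinearMap.range Ak.mulVecLin) ≤ Module.finrank ℤ M := by
    let t : (Fin d → ℤ) →ₗ[ℤ] (Fin d → k) := (Int.castAddHom k).toIntLinearMap.compLeft (Fin d)
    have h2 : ∀ x ∈ M, t x ∈ Submodule.span k (Set.range fun i => t (b i : Fin d → ℤ)) := by
      intro x hx
      have h := congrArg (fun z : M => t z) (b.sum_repr ⟨x, hx⟩)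
      simp only at h
      rw [← h]
      simp only [AddSubmonoidClass.coe_finsetSum, map_sum, Submodule.coe_smul, map_smul]
      refine sum_mem fun i _ => zsmul_mem (Submodule.subset_span ?_) _
      exact ⟨i, rfl⟩
    rw [Matrix.range_mulVecLin]
    refine le_trans (Submodule.finrank_mono (t := Submodule.span k (Set.range fun i => t (b i : Fin d → ℤ))) ?_) ?_
    · rw [Submodule.span_le]
      rintro _ ⟨j, rfl⟩
      exact h2 (A.col j) (Submodule.subset_span ⟨j, rfl⟩)
    · exact (finrank_range_le_card _).trans (by simp)
  have hrn := LinearMap.finrank_range_add_finrank_ker Ak.mulVecLin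
  rw [Module.finrank_fin_fun] at hrn
  let V : Matrix (Fin n) (Fin (Module.finrank k K)) k := Matrix.of fun j s => (v s : Fin n → k) j
  have hV : LinearMap.ker V.mulVecLin = ⊥ := by
    rw [Matrix.ker_mulVecLin_eq_bot_iff, ]
    have := v.linearIndependent.map' K.subtype K.ker_subtype
    intro w hw
    rw [Fintype.linearIndependent_iff] at this
    funext s
    refine this w ?_ s
    funext j
    have := congrFun hw j
    simpa [V, Matrix.mulVec, dotProduct, mul_comm] using this
  obtain ⟨g, hg⟩ := LinearMap.exists_leftInverse_of_injective _ hV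
  refine ⟨Fintype.card κ, _, a ∘ e.symm, V, LinearMap.toMatrix' g, ?_, ?_, ?_, ?_⟩
  · have h := (LinearIndependent.iff_fractionRing ℤ ℚ).mpr hli
    have h' : LinearIndependent ℤ (fun i => A.col (a i)) := LinearIndependent.of_comp q h
    exact h'.comp _ e.symm.injective
  · ext i s
    exact congrFun (LinearMap.mem_ker.mp (v s).2) i
  · have := congrArg LinearMap.toMatrix' hg
    rwa [LinearMap.toMatrix'_comp, LinearMap.toMatrix'_id, ← Matrix.toLin'_apply', LinearMap.toMatrix'_toLin'] at this
  · change _ + Module.finrank k K = n at hrn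
    omega

theorem ker_data (k : Type*) [Field k] {d n : ℕ} (A : Matrix (Fin d) (Fin n) ℤ) (r m : ℕ)
    (c : Fin r → Fin n) (V : Matrix (Fin n) (Fin m) k) (G : Matrix (Fin m) (Fin n) k)
    (hc : LinearIndependent ℤ (fun j => A.col (c j)))
    (hV : (A.map (Int.cast : ℤ → k)) * V = 0) (hG : G * V = 1) :
    ((r + m : ℕ) : WithBot ℕ∞) ≤ ringKrullDim (MvPolynomial (Fin n ⊕ Fin n) k ⧸
      (toricIdeal k A (Sum.inr : Fin n → Fin n ⊕ Fin n) + eulerIdeal k A)) := by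
  classical
  let L : Fin n → (MvPolynomial (Fin m) k) := fun j => ∑ s, V j s • X s
  let val : Fin n ⊕ Fin n → (AddMonoidAlgebra (MvPolynomial (Fin m) k) (Fin d → ℤ)) := Sum.elim (fun j => AddMonoidAlgebra.single (-(A.col j)) (L j))
    (fun j => AddMonoidAlgebra.single (A.col j) 1)
  let φ : MvPolynomial (Fin n ⊕ Fin n) k →ₐ[k] (AddMonoidAlgebra (MvPolynomial (Fin m) k) (Fin d → ℤ)) := aeval val
  have hxξ : ∀ j, val (Sum.inl j) * val (Sum.inr j) = AddMonoidAlgebra.single 0 (L j) := by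
    intro j
    simp [val, AddMonoidAlgebra.single_mul_single]
  -- the kernel contains the ideal
  have hker : toricIdeal k A (Sum.inr : Fin n → Fin n ⊕ Fin n) + eulerIdeal k A ≤
      RingHom.ker φ.rangeRestrict.toRingHom := by
    have hk : RingHom.ker φ.rangeRestrict.toRingHom = RingHom.ker φ := by
      ext x
      simp only [RingHom.mem_ker]
      exact (Subtype.ext_iff (a1 := φ.rangeRestrict x) (a2 := 0))
    rw [hk]
    refine sup_le (Ideal.span_le.mpr ?_) (Ideal.span_le.mpr ?_)
    · rintro _ ⟨u, v, huv, rfl⟩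
      have key : ∀ u : Fin n → ℕ, φ (∏ j, X (Sum.inr j) ^ u j) =
          AddMonoidAlgebra.single (A.mulVec (fun j => (u j : ℤ))) 1 := by
        intro u
        have : A.mulVec (fun j => (u j : ℤ)) = ∑ j, u j • A.col j := by
          funext i
          simp [Matrix.mulVec, dotProduct, mul_comm]
        rw [this]
        simp only [φ, map_prod, map_pow, aeval_X, val, Sum.elim_inr,
          AddMonoidAlgebra.single_pow, one_pow]
        have h : ∀ s : Finset (Fin n),
            ∏ j ∈ s, (AddMonoidAlgebra.single (u j • A.col j) 1 : (AddMonoidAlgebra (MvPolynomial (Fin m) k) (Fin d → ℤ))) =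
              AddMonoidAlgebra.single (∑ j ∈ s, u j • A.col j) 1 := by
          intro s
          induction s using Finset.induction_on with
          | empty => simp [AddMonoidAlgebra.one_def]
          | insert a s ha ih =>
            rw [Finset.prod_insert ha, Finset.sum_insert ha, ih,
              AddMonoidAlgebra.single_mul_single, one_mul]
        exact h _
      simp only [SetLike.mem_coe, RingHom.mem_ker]
      rw [map_sub, key, key, huv, sub_self]
    · rintro _ ⟨i, rfl⟩
      simp only [SetLike.mem_coe, RingHom.mem_ker, φ, map_sum, map_mul, aeval_X, mul_assoc, hxξ,
        map_intCast]
      have h0 : ∑ j, (A i j : (MvPolynomial (Fin m) k)) * L j = 0 := by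
        simp only [L, Finset.mul_sum]
        rw [Finset.sum_comm]
        refine Finset.sum_eq_zero fun s _ => ?_
        have := congrFun (congrFun hV i) s
        simp only [Matrix.mul_apply, Matrix.map_apply, Matrix.zero_apply] at this
        have h1 : ∑ j, (A i j : (MvPolynomial (Fin m) k)) * V j s • (X s : (MvPolynomial (Fin m) k)) =
            (∑ j, (A i j : k) * V j s) • (X s : (MvPolynomial (Fin m) k)) := by
          rw [Finset.sum_smul]
          refine Finset.sum_congr rfl fun j _ => ?_
          rw [mul_smul, Algebra.smul_def (A i j : k), map_intCast]
        rw [h1, this, zero_smul]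
      have h2 := congrArg (AddMonoidAlgebra.singleZeroRingHom : (MvPolynomial (Fin m) k) →+* (AddMonoidAlgebra (MvPolynomial (Fin m) k) (Fin d → ℤ))) h0
      simp only [map_sum, map_mul, map_intCast, map_zero] at h2
      exact h2
  have hfin : Algebra.FiniteType k φ.range :=
    Algebra.FiniteType.of_surjective φ.rangeRestrict φ.rangeRestrict_surjective
  have hdom : IsDomain (AddMonoidAlgebra (MvPolynomial (Fin m) k) (Fin d → ℤ)) := inferInstance
  let p : Fin r ⊕ Fin m → MvPolynomial (Fin n ⊕ Fin n) k := Sum.elim (fun i => X (Sum.inr (c i)))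
    (fun s => ∑ j, G s j • (X (Sum.inl j) * X (Sum.inr j)))
  let f : (Fin r →₀ ℕ) →+ (Fin d → ℤ) :=
    { toFun := fun w => ∑ i, w i • A.col (c i)
      map_zero' := by simp
      map_add' := fun a b => by simp [add_smul, Finset.sum_add_distrib] }
  have hf : Function.Injective f := by
    intro a b hab
    have h : ∑ i, ((a i : ℤ) - b i) • A.col (c i) = 0 := by
      simp only [sub_smul, Finset.sum_sub_distrib, natCast_zsmul]
      exact sub_eq_zero.mpr hab
    ext i
    have := Fintype.linearIndependent_iff.mp hc _ h i
    omega
  let ψ : MvPolynomial (Fin r ⊕ Fin m) k →ₐ[k] (AddMonoidAlgebra (MvPolynomial (Fin m) k) (Fin d → ℤ)) :=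
    (AddMonoidAlgebra.mapDomainAlgHom k (MvPolynomial (Fin m) k) f).comp (sumAlgEquiv k (Fin r) (Fin m)).toAlgHom
  have hψ : Function.Injective ψ :=
    (AddMonoidAlgebra.mapDomain_injective hf).comp (sumAlgEquiv k (Fin r) (Fin m)).injective
  have hψp : aeval (fun i => φ (p i)) = ψ := by
    ext1 i
    rw [aeval_X]
    rcases i with i | s
    · have h1 : ψ (X (Sum.inl i)) = AddMonoidAlgebra.mapDomain f (X i : MvPolynomial (Fin r) (MvPolynomial (Fin m) k)) := by
        change AddMonoidAlgebra.mapDomain f (sumAlgEquiv k (Fin r) (Fin m) (X (Sum.inl i))) = _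
        rw [sumAlgEquiv_X_inl]
      rw [h1, X, monomial]
      have h2 : f (Finsupp.single i 1) = A.col (c i) := by
        change ∑ j, (Finsupp.single i 1 : Fin r →₀ ℕ) j • A.col (c j) = _
        rw [Finset.sum_eq_single i] <;> simp +contextual [eq_comm]
      simp [p, φ, val, h2]
    · have h1 : ψ (X (Sum.inr s)) =
          AddMonoidAlgebra.mapDomain f (MvPolynomial.C (X s) : MvPolynomial (Fin r) (MvPolynomial (Fin m) k)) := by
        change AddMonoidAlgebra.mapDomain f (sumAlgEquiv k (Fin r) (Fin m) (X (Sum.inr s))) = _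
        rw [sumAlgEquiv_X_inr]
      have h0 : ∑ j, G s j • L j = X s := by
        simp only [L, Finset.smul_sum, smul_smul]
        rw [Finset.sum_comm]
        simp only [← Finset.sum_smul]
        have h3 : ∀ t, ∑ j, G s j * V j t = (1 : Matrix (Fin m) (Fin m) k) s t := by
          intro t
          rw [← hG, Matrix.mul_apply]
        simp [h3, Matrix.one_apply]
      have h4 : φ (p (Sum.inr s)) = ∑ j, G s j • AddMonoidAlgebra.single 0 (L j) := by
        simp only [p, Sum.elim_inr, map_sum, map_smul, φ, map_mul, aeval_X, hxξ]
      have h5 : ∑ j, G s j • (AddMonoidAlgebra.single 0 (L j) : (AddMonoidAlgebra (MvPolynomial (Fin m) k) (Fin d → ℤ))) =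
          AddMonoidAlgebra.single 0 (X s) := by
        rw [← h0]
        have := map_sum (AddMonoidAlgebra.singleZeroRingHom : (MvPolynomial (Fin m) k) →+* (AddMonoidAlgebra (MvPolynomial (Fin m) k) (Fin d → ℤ))) (fun j => G s j • L j)
          Finset.univ
        refine Eq.trans (Finset.sum_congr rfl fun j _ => ?_) this.symm
        simp
      rw [h1, h4, h5, C_apply, monomial]
      simp
  have hai : AlgebraicIndependent k (fun i => φ.rangeRestrict (p i)) := by
    refine AlgebraicIndependent.of_comp φ.range.val ?_
    change Function.Injective (aeval (fun i => φ (p i)))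
    rw [hψp]
    exact hψ
  have h := card_le_ringKrullDim_of_algebraicIndependent _ hai
  rw [Nat.card_sum, Nat.card_fin, Nat.card_fin] at h
  refine h.trans (ringKrullDim_le_of_surjective (Ideal.Quotient.lift _ φ.rangeRestrict.toRingHom
    (fun a ha => hker ha)) ?_)
  exact Ideal.Quotient.lift_surjective_of_surjective _ _ φ.rangeRestrict_surjective

/-- The quotient ring `k[x,ξ]/(I_A + ⟨Axξ⟩)` has Krull
dimension at least `n`. -/
theorem krullDim_quotient_toric_euler_ge (k : Type*) [Field k] (d n : ℕ)
    (A : Matrix (Fin d) (Fin n) ℤ) :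
    (n : WithBot ℕ∞) ≤ ringKrullDim (MvPolynomial (Fin n ⊕ Fin n) k ⧸
      (toricIdeal k A (Sum.inr : Fin n → Fin n ⊕ Fin n) + eulerIdeal k A)) := by
  obtain ⟨r, m, c, V, G, hc, hV, hG, hn⟩ := exists_lin_data k A
  refine le_trans ?_ (ker_data k A r m c V G hc hV hG)
  exact_mod_cast hn
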